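/- arXiv:2105.11810 — 11 statements merged into one kernel-verified Lean document; each statement's English description precedes it below -/
import Mathlib

section
/- Let 𝒮₁ and 𝒮₂ be semigroups of sets on a set X and let ℐ be an ideal of sets on X. Then (𝒮₁ ∨ 𝒮₂) * ℐ = (𝒮₁ * ℐ) ∨ (𝒮₂ * ℐ) and ℐ * (𝒮₁ ∨ 𝒮₂) = (ℐ * 𝒮₁) ∨ (ℐ * 𝒮₂). -/
/-- A semigroup of sets on `X`: a nonempty family of subsets of `X`
closed under binary unions. -/
def IsSetSemigroup {X : Type*} (S : Set (Set X)) : Prop :=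
  S.Nonempty ∧ ∀ A ∈ S, ∀ B ∈ S, A ∪ B ∈ S

/-- An ideal of sets on `X`: a nonempty family of subsets of `X` closed under
binary unions and under taking subsets. -/
def IsSetIdeal {X : Type*} (I : Set (Set X)) : Prop :=
  I.Nonempty ∧ (∀ A ∈ I, ∀ B ∈ I, A ∪ B ∈ I) ∧ (∀ A ∈ I, ∀ B, B ⊆ A → B ∈ I)

/-- The family `𝒜 ∨ ℬ = {A ∪ B : A ∈ 𝒜, B ∈ ℬ}`. -/
def veeFam {X : Type*} (A B : Set (Set X)) : Set (Set X) :=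
  {U | ∃ S₁ ∈ A, ∃ S₂ ∈ B, U = S₁ ∪ S₂}

/-- The family `𝒜 * ℬ = {(A \ B₁) ∪ B₂ : A ∈ 𝒜, B₁ ∈ ℬ, B₂ ∈ ℬ}`. -/
def starFam {X : Type*} (A B : Set (Set X)) : Set (Set X) :=
  {U | ∃ S ∈ A, ∃ B₁ ∈ B, ∃ B₂ ∈ B, U = (S \ B₁) ∪ B₂}

theorem stmt_3 {X : Type*} (S₁ S₂ I : Set (Set X))
    (h₁ : IsSetSemigroup S₁) (h₂ : IsSetSemigroup S₂) (hI : IsSetIdeal I) :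
    starFam (veeFam S₁ S₂) I = veeFam (starFam S₁ I) (starFam S₂ I) ∧
    starFam I (veeFam S₁ S₂) = veeFam (starFam I S₁) (starFam I S₂) := by
  obtain ⟨-, hunion, hsub⟩ := hI
  refine ⟨Set.Subset.antisymm ?_ ?_, Set.Subset.antisymm ?_ ?_⟩
  · rintro _ ⟨_, ⟨A, hA, B, hB, rfl⟩, P, hP, Q, hQ, rfl⟩
    refine ⟨_, ⟨A, hA, P, hP, Q, hQ, rfl⟩, _, ⟨B, hB, P, hP, Q, hQ, rfl⟩, ?_⟩
    rw [Set.union_sdiff_distrib, Set.union_union_distrib_right]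
  · rintro _ ⟨_, ⟨A, hA, P, hP, Q, hQ, rfl⟩, _, ⟨B, hB, P', hP', Q', hQ', rfl⟩, rfl⟩
    refine ⟨_, ⟨A, hA, B, hB, rfl⟩, (A ∪ B) \ ((A \ P ∪ Q) ∪ (B \ P' ∪ Q')),
      hsub _ (hunion P hP P' hP') _ ?_, _, hunion Q hQ Q' hQ', ?_⟩
    · intro x
      simp only [Set.mem_sdiff, Set.mem_union]
      tauto
    · ext x
      simp only [Set.mem_sdiff, Set.mem_union]
      tauto
  · rintro _ ⟨J, hJ, _, ⟨A, hA, B, hB, rfl⟩, _, ⟨A', hA', B', hB', rfl⟩, rfl⟩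
    have hK : J \ (A ∪ B) ∈ I := hsub J hJ _ Set.sdiff_subset
    refine ⟨_, ⟨_, hK, A, hA, A', hA', rfl⟩, _, ⟨_, hK, B, hB, B', hB', rfl⟩, ?_⟩
    ext x
    simp only [Set.mem_sdiff, Set.mem_union]
    tauto
  · -- Removing `A' ∪ B'` is harmless because it is added back afterwards.
    rintro _ ⟨_, ⟨J, hJ, A, hA, A', hA', rfl⟩, _, ⟨K, hK, B, hB, B', hB', rfl⟩, rfl⟩
    refine ⟨J \ A ∪ K \ B,
      hunion _ (hsub J hJ _ Set.sdiff_subset) _ (hsub K hK _ Set.sdiff_subset),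
      _, ⟨A', hA', B', hB', rfl⟩, _, ⟨A', hA', B', hB', rfl⟩, ?_⟩
    rw [Set.sdiff_union_self, Set.union_union_union_comm]
end

section
/- Let B be a subset of ℝ that is simultaneously a Bernstein set and a subgroup of the additive group (ℝ, +). Then every finite union of cosets of B, i.e., every set of the form (B + x₁) ∪ (B + x₂) ∪ ⋯ ∪ (B + xₙ) with x₁, …, xₙ ∈ ℝ and n ≥ 1, is a Bernstein set in ℝ. (Consequently its complement in ℝ is also a Bernstein set.) -/
/-- A Bernstein set: a set `B ⊆ ℝ` such that every uncountable closed subset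
`F` of `ℝ` meets both `B` and its complement. -/
def IsBernstein (B : Set ℝ) : Prop :=
  ∀ F : Set ℝ, IsClosed F → ¬F.Countable → (F ∩ B).Nonempty ∧ (F ∩ Bᶜ).Nonempty

theorem IsBernstein.compl {B : Set ℝ} (hB : IsBernstein B) : IsBernstein Bᶜ := by
  intro F hF hFc
  rw [compl_compl]
  exact (hB F hF hFc).symm

/-- Every uncountable closed set meets every translate of a Bernstein set. -/
theorem IsBernstein.exists_add_mem {B : Set ℝ} (hB : IsBernstein B) {F : Set ℝ}
    (hF : IsClosed F) (hFc : ¬F.Countable) (y : ℝ) : ∃ b ∈ B, b + y ∈ F := by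
  have hcl : IsClosed ((fun b => b + y) ⁻¹' F) := hF.preimage (continuous_add_const y)
  have hunc : ¬((fun b => b + y) ⁻¹' F).Countable := by
    intro h
    apply hFc
    rw [← Set.image_preimage_eq F (add_right_surjective y)]
    exact h.image _
  obtain ⟨b, hbF, hbB⟩ := (hB _ hcl hunc).1
  exact ⟨b, hbB, hbF⟩

/-- A proper subgroup of `ℝ` is not covered, up to translation, by finitely many cosets:
since `ℝ` is divisible, the subgroup has infinite index. -/
theorem AddSubgroup.exists_forall_sub_notMem {G : AddSubgroup ℝ} (hG : G ≠ ⊤)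
    {ι : Type*} [Finite ι] (x : ι → ℝ) : ∃ y, ∀ i, y - x i ∉ G := by
  by_contra! h
  have hsurj : Function.Surjective (fun i => (x i : ℝ ⧸ G)) := by
    intro q
    obtain ⟨y, rfl⟩ := QuotientAddGroup.mk_surjective q
    obtain ⟨i, hi⟩ := h y
    refine ⟨i, QuotientAddGroup.eq.2 ?_⟩
    rwa [neg_add_eq_sub]
  have : Finite (ℝ ⧸ G) := Finite.of_surjective _ hsurj
  have hindex : G.index ≠ 0 := G.index_ne_zero_of_finite
  refine hG ((AddSubgroup.eq_top_iff' G).2 fun r => ?_)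
  have hr := G.nsmul_index_mem (r / G.index)
  rwa [nsmul_eq_mul, mul_div_cancel₀ _ (Nat.cast_ne_zero.2 hindex)] at hr

theorem stmt_4 (B : Set ℝ) (hB : IsBernstein B)
    (hsub : ∃ G : AddSubgroup ℝ, (G : Set ℝ) = B)
    (n : ℕ) (x : Fin (n + 1) → ℝ) :
    IsBernstein (⋃ i, (fun b => b + x i) '' B) ∧
    IsBernstein ((⋃ i, (fun b => b + x i) '' B)ᶜ) := by
  obtain ⟨G, rfl⟩ := hsub
  have hG : G ≠ ⊤ := by
    rintro rfl
    obtain ⟨z, -, hz⟩ := (hB Set.univ isClosed_univ Cardinal.not_countable_real).2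
    exact hz (AddSubgroup.mem_top z)
  have hU : IsBernstein (⋃ i, (fun b => b + x i) '' (G : Set ℝ)) := by
    intro F hF hFc
    constructor
    · obtain ⟨b, hb, hbF⟩ := hB.exists_add_mem hF hFc (x 0)
      exact ⟨b + x 0, hbF, Set.mem_iUnion.2 ⟨0, b, hb, rfl⟩⟩
    · obtain ⟨y, hy⟩ := AddSubgroup.exists_forall_sub_notMem hG x
      obtain ⟨b, hb, hbF⟩ := hB.exists_add_mem hF hFc y
      refine ⟨b + y, hbF, fun hmem => ?_⟩
      obtain ⟨i, c, hc, hci⟩ := Set.mem_iUnion.1 hmem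
      apply hy i
      have hsub : y - x i = c - b := by
        have hci : c + x i = b + y := hci
        linarith
      rw [hsub]
      exact G.sub_mem hc hb
  exact ⟨hU, hU.compl⟩
end

section
/- Let B be a subset of ℝ that is simultaneously a Bernstein set and a proper subgroup of (ℝ, +), and let Y be a bounded subset of some coset B + x of B. Then there exists a bounded sequence (h_k)_{k ∈ ℕ} of real numbers such that the translates Y + h_k, k ∈ ℕ, are pairwise disjoint (i.e., (Y + h_j) ∩ (Y + h_k) = ∅ whenever j ≠ k). -/
/-- A proper subgroup of `ℝ` has infinitely many cosets, since `ℝ` is divisible. -/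
theorem infinite_quotient_of_ne_top {G : AddSubgroup ℝ} (hG : G ≠ ⊤) : Infinite (ℝ ⧸ G) := by
  by_contra hfin
  rw [not_infinite_iff_finite] at hfin
  have hindex : G.index ≠ 0 := AddSubgroup.index_ne_zero_of_finite
  refine hG (eq_top_iff.2 fun a _ => ?_)
  have ha := G.nsmul_index_mem (a / G.index)
  rwa [nsmul_eq_mul, mul_div_cancel₀ a (Nat.cast_ne_zero.2 hindex)] at ha

/-- Every coset of a subgroup of `ℝ` that is a Bernstein set meets `[0, 1]`. -/
theorem IsBernstein.exists_mk_eq {G : AddSubgroup ℝ} (hG : IsBernstein (G : Set ℝ))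
    (q : ℝ ⧸ G) : ∃ a ∈ Set.Icc (0 : ℝ) 1, (a : ℝ ⧸ G) = q := by
  obtain ⟨c, rfl⟩ := QuotientAddGroup.mk_surjective q
  have hc : ¬(Set.Icc (c - 1) c).Countable := by
    rw [← Cardinal.le_aleph0_iff_set_countable, Cardinal.mk_Icc_real (by linarith), not_le]
    exact Cardinal.aleph0_lt_continuum
  obtain ⟨b, hb, hbG⟩ := (hG _ isClosed_Icc hc).1
  refine ⟨c - b, ⟨by linarith [hb.2], by linarith [hb.1]⟩, ?_⟩
  rw [QuotientAddGroup.eq]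
  simpa using hbG

theorem stmt_7 (B : Set ℝ) (hB : IsBernstein B)
    (hsub : ∃ G : AddSubgroup ℝ, (G : Set ℝ) = B ∧ G ≠ ⊤)
    (x : ℝ) (Y : Set ℝ) (hYsub : Y ⊆ (fun b => b + x) '' B)
    (hYbd : ∃ r : ℝ, Y ⊆ Set.Icc (-r) r) :
    ∃ h : ℕ → ℝ, (∃ r : ℝ, ∀ k, h k ∈ Set.Icc (-r) r) ∧
      ∀ j k : ℕ, j ≠ k →
        ((fun y => y + h j) '' Y) ∩ ((fun y => y + h k) '' Y) = ∅ := by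
  obtain ⟨G, rfl, hG⟩ := hsub
  have := infinite_quotient_of_ne_top hG
  choose h h_mem h_mk using fun k => hB.exists_mk_eq (Infinite.natEmbedding (ℝ ⧸ G) k)
  refine ⟨h, ⟨1, fun k => ⟨by linarith [(h_mem k).1], (h_mem k).2⟩⟩, fun j k hjk => ?_⟩
  rw [Set.eq_empty_iff_forall_notMem]
  rintro _ ⟨⟨y, hy, rfl⟩, z, hz, hzy⟩
  obtain ⟨b, hb, rfl⟩ := hYsub hy
  obtain ⟨c, hc, rfl⟩ := hYsub hz
  refine hjk ((Infinite.natEmbedding (ℝ ⧸ G)).injective ?_)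
  rw [← h_mk, ← h_mk, QuotientAddGroup.eq]
  have hbc : -h j + h k = b - c := by
    simp only at hzy
    linarith
  rw [hbc]
  exact G.sub_mem hb hc
end

section
/- Let B be a subset of ℝ that is simultaneously a Bernstein set and a proper subgroup of (ℝ, +). Then no finite union U = (B + x₁) ∪ ⋯ ∪ (B + xₙ) of cosets of B contains a Lebesgue measurable set of positive Lebesgue measure; equivalently, every Lebesgue measurable subset of U has Lebesgue measure zero. -/
open MeasureTheory

/-- A Bernstein set is dense in `ℝ`. -/
lemma IsBernstein.dense {B : Set ℝ} (hB : IsBernstein B) : Dense B := by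
  refine Metric.dense_iff.2 fun r ε hε => ?_
  have hunc : ¬(Set.Icc (r - ε / 2) (r + ε / 2)).Countable := by
    intro hc
    have h0 := hc.measure_zero volume
    rw [Real.volume_Icc, ENNReal.ofReal_eq_zero] at h0
    linarith
  obtain ⟨b, hb, hbB⟩ := (hB _ isClosed_Icc hunc).1
  refine ⟨b, ?_, hbB⟩
  rw [Metric.mem_ball, Real.dist_eq, abs_lt]
  constructor <;> linarith [hb.1, hb.2]

/-- Since `ℝ` is divisible, its only subgroup with finite quotient is `ℝ` itself. -/
lemma AddSubgroup.eq_top_of_finite_real_quotient (G : AddSubgroup ℝ) [Finite (ℝ ⧸ G)] :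
    G = ⊤ := by
  refine (AddSubgroup.eq_top_iff' G).2 fun r => ?_
  have hN : (Nat.card (ℝ ⧸ G) : ℝ) ≠ 0 := Nat.cast_ne_zero.2 Nat.card_pos.ne'
  have h := card_nsmul_eq_zero' (x := ((r / Nat.card (ℝ ⧸ G) : ℝ) : ℝ ⧸ G))
  rw [← QuotientAddGroup.mk_nsmul, nsmul_eq_mul, mul_div_cancel₀ _ hN] at h
  exact (QuotientAddGroup.eq_zero_iff r).1 h

/-- A dense proper subgroup of `ℝ` has no measurable set of positive measure inside a finite
union of its cosets. -/
lemma AddSubgroup.volume_eq_zero_of_subset_iUnion_cosets {G : AddSubgroup ℝ}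
    (hd : Dense (G : Set ℝ)) (hG : G ≠ ⊤) {ι : Type*} [Finite ι] (x : ι → ℝ) {Y : Set ℝ}
    (hY : Y ⊆ ⋃ i, (fun b => b + x i) '' (G : Set ℝ)) (hm : MeasurableSet Y) :
    volume Y = 0 := by
  by_contra hpos
  have hnhds := Measure.sub_mem_nhds_zero_of_addHaar_pos volume Y hm (pos_iff_ne_zero.2 hpos)
  obtain ⟨ε, hε, hball⟩ := Metric.mem_nhds_iff.1 hnhds
  have hsurj : Function.Surjective
      (fun p : ι × ι => ((x p.1 - x p.2 : ℝ) : ℝ ⧸ G)) := by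
    intro q
    obtain ⟨r, rfl⟩ := QuotientAddGroup.mk_surjective q
    obtain ⟨b, hb, hbG⟩ := Metric.dense_iff.1 hd r ε hε
    have hmem : b - r ∈ Metric.ball (0 : ℝ) ε := by
      simpa [Real.dist_eq] using hb
    obtain ⟨y, hy, z, hz, hyz⟩ := Set.mem_sub.1 (hball hmem)
    obtain ⟨i, g, hg, rfl⟩ := Set.mem_iUnion.1 (hY hy)
    obtain ⟨j, k, hk, rfl⟩ := Set.mem_iUnion.1 (hY hz)
    refine ⟨(j, i), (QuotientAddGroup.eq (s := G)).2 ?_⟩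
    have heq : -(x j - x i) + r = b - g + k := by
      simp only at hyz
      linarith
    rw [heq]
    exact G.add_mem (G.sub_mem hbG hg) hk
  have := Finite.of_surjective _ hsurj
  exact hG G.eq_top_of_finite_real_quotient

theorem stmt_8 (B : Set ℝ) (hB : IsBernstein B)
    (hsub : ∃ G : AddSubgroup ℝ, (G : Set ℝ) = B ∧ G ≠ ⊤)
    (n : ℕ) (x : Fin (n + 1) → ℝ)
    (U : Set ℝ) (hU : U = ⋃ i, (fun b => b + x i) '' B) :
    ∀ Y : Set ℝ, Y ⊆ U → NullMeasurableSet Y volume → volume Y = 0 := by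
  intro Y hYU hY
  obtain ⟨G, rfl, hG⟩ := hsub
  obtain ⟨Z, hZY, hZ, hZae⟩ := hY.exists_measurable_subset_ae_eq
  rw [← measure_congr hZae]
  exact AddSubgroup.volume_eq_zero_of_subset_iUnion_cosets hB.dense hG x
    (hU ▸ hZY.trans hYU) hZ
end

section
/- Let B₁ and B₂ be subsets of ℝ, each simultaneously a Bernstein set and a proper subgroup of (ℝ, +). Let U₁ be a finite union of cosets of B₁ and U₂ a finite union of cosets of B₂. Then the set U₁ ∪ U₂ contains no Lebesgue measurable set of positive Lebesgue measure; equivalently, every Lebesgue measurable subset of U₁ ∪ U₂ has Lebesgue measure zero. -/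
open MeasureTheory

/-- `U` is a finite union of cosets (translates) of `B`. -/
def FinUnionCosets (B U : Set ℝ) : Prop :=
  ∃ (m : ℕ) (x : Fin (m + 1) → ℝ), U = ⋃ i, (fun b => b + x i) '' B

open Filter Topology Pointwise in
/-- A compact set of positive measure contains arithmetic progressions of any given length and any
sufficiently small step. -/
theorem IsCompact.eventually_exists_forall_add_mul_mem {K : Set ℝ} (hK : IsCompact K)
    (hpos : volume K ≠ 0) (N : ℕ) :
    ∀ᶠ t in 𝓝 (0 : ℝ), ∃ x, ∀ i ∈ Finset.range N, x + (i : ℝ) * t ∈ K := by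
  have hlim : Tendsto (fun t : ℝ ↦ ∑ i ∈ Finset.range N, volume (((i : ℝ) * t +ᵥ K) \ K))
      (𝓝 0) (𝓝 0) := by
    rw [← Finset.sum_const_zero (s := Finset.range N) (M := ENNReal)]
    refine tendsto_finsetSum _ fun i _ ↦ ?_
    have hmul : Tendsto (fun t : ℝ ↦ (i : ℝ) * t) (𝓝 0) (𝓝 0) :=
      (continuous_const_mul (i : ℝ)).tendsto' _ _ (mul_zero _)
    exact (tendsto_measure_vadd_sdiff_isCompact_isClosed hK hK.isClosed).comp hmul
  filter_upwards [hlim.eventually_lt_const (pos_iff_ne_zero.2 hpos)] with t ht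
  by_contra! hne
  have hcover : K ⊆ ⋃ i ∈ Finset.range N,
      (fun x ↦ (i : ℝ) * t + x) ⁻¹' (((i : ℝ) * t +ᵥ K) \ K) := by
    intro x hx
    obtain ⟨i, hi, hxi⟩ := hne x
    exact Set.mem_biUnion hi ⟨Set.vadd_mem_vadd_set hx, by simpa [add_comm] using hxi⟩
  refine ht.not_ge ?_
  calc volume K ≤ _ := measure_mono hcover
    _ ≤ _ := measure_biUnion_finset_le _ _
    _ = _ := by simp only [measure_preimage_add]

theorem AddSubgroup.exists_notMem_and_notMem {A : Type*} [AddGroup A] {G H : AddSubgroup A}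
    (hG : G ≠ ⊤) (hH : H ≠ ⊤) : ∃ a, a ∉ G ∧ a ∉ H := by
  obtain ⟨a, ha⟩ : ∃ a, a ∉ G := by simpa [AddSubgroup.eq_top_iff'] using hG
  obtain ⟨b, hb⟩ : ∃ b, b ∉ H := by simpa [AddSubgroup.eq_top_iff'] using hH
  by_contra! h
  by_cases hbG : b ∈ G
  · have haH := h a ha
    have hab : a + b ∉ G := fun hab ↦ ha ((G.add_mem_cancel_right hbG).1 hab)
    exact hb ((H.add_mem_cancel_left haH).1 (h _ hab))
  · exact hb (h b hbG)

theorem AddSubgroup.sub_mul_notMem {G : AddSubgroup ℝ} {t : ℝ} {N : ℕ}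
    (ht : (N.factorial : ℝ) * t ∉ G) {x : ℝ} {i j : ℕ} (hij : i < j) (hj : j ≤ N) :
    (x + j * t) - (x + i * t) ∉ G := by
  intro h
  obtain ⟨c, hc⟩ : j - i ∣ N.factorial := Nat.dvd_factorial (by lia) (by lia)
  refine ht ?_
  have hmem := G.nsmul_mem h c
  rw [hc]
  convert hmem using 1
  push_cast [Nat.cast_sub hij.le, nsmul_eq_mul]
  ring

theorem FinUnionCosets.exists_cover {G : AddSubgroup ℝ} {U : Set ℝ}
    (hU : FinUnionCosets (G : Set ℝ) U) :
    ∃ (m : ℕ) (x : Fin m → ℝ), ∀ u ∈ U, ∃ i, u - x i ∈ G := by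
  obtain ⟨m, x, rfl⟩ := hU
  refine ⟨m + 1, x, fun u hu ↦ ?_⟩
  obtain ⟨i, b, hb, rfl⟩ := Set.mem_iUnion.1 hu
  exact ⟨i, by simpa using hb⟩

open Filter Topology in
theorem stmt_10 (B₁ B₂ : Set ℝ)
    (hB₁ : IsBernstein B₁) (hB₂ : IsBernstein B₂)
    (hsub₁ : ∃ G : AddSubgroup ℝ, (G : Set ℝ) = B₁ ∧ G ≠ ⊤)
    (hsub₂ : ∃ G : AddSubgroup ℝ, (G : Set ℝ) = B₂ ∧ G ≠ ⊤)
    (U₁ U₂ : Set ℝ) (hU₁ : FinUnionCosets B₁ U₁) (hU₂ : FinUnionCosets B₂ U₂) :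
    ∀ Y : Set ℝ, Y ⊆ U₁ ∪ U₂ → NullMeasurableSet Y volume → volume Y = 0 := by
  intro Y hYU hY
  obtain ⟨G, rfl, hG⟩ := hsub₁
  obtain ⟨H, rfl, hH⟩ := hsub₂
  obtain ⟨m, x, hx⟩ := hU₁.exists_cover
  obtain ⟨n, y, hy⟩ := hU₂.exists_cover
  by_contra hpos
  obtain ⟨T, hTY, hT, hTae⟩ := hY.exists_measurable_subset_ae_eq
  obtain ⟨K, hKT, hK, hKpos⟩ := hT.exists_lt_isCompact
    (pos_iff_ne_zero.2 (by rwa [measure_congr hTae]) : 0 < volume T)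
  obtain ⟨h, hhG, hhH⟩ := AddSubgroup.exists_notMem_and_notMem hG hH
  set N := m + n + 1
  have hlim : Tendsto (fun k : ℕ ↦ h / N.factorial / ((k : ℝ) + 1)) atTop (𝓝 0) := by
    simpa [div_eq_mul_inv] using
      (tendsto_one_div_add_atTop_nhds_zero_nat (𝕜 := ℝ)).const_mul (h / N.factorial)
  obtain ⟨k, a, ha⟩ :=
    (hlim.eventually (hK.eventually_exists_forall_add_mul_mem hKpos.ne' N)).exists
  set t := h / N.factorial / ((k : ℝ) + 1) with ht
  have hth : (k + 1) • ((N.factorial : ℝ) * t) = h := by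
    have : (N.factorial : ℝ) ≠ 0 := by positivity
    have : (k : ℝ) + 1 ≠ 0 := by positivity
    rw [ht, nsmul_eq_mul]
    push_cast
    field_simp
  have htG : (N.factorial : ℝ) * t ∉ G := fun h' ↦ hhG (hth ▸ G.nsmul_mem h' (k + 1))
  have htH : (N.factorial : ℝ) * t ∉ H := fun h' ↦ hhH (hth ▸ H.nsmul_mem h' (k + 1))
  have hcoset : ∀ i : Fin N, ∃ c : Fin m ⊕ Fin n,
      Sum.elim (fun p ↦ a + (i : ℕ) * t - x p ∈ G) (fun q ↦ a + (i : ℕ) * t - y q ∈ H) c := by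
    intro i
    rcases hYU (hTY (hKT (ha i (Finset.mem_range.2 i.2)))) with hu | hu
    · obtain ⟨p, hp⟩ := hx _ hu
      exact ⟨.inl p, hp⟩
    · obtain ⟨q, hq⟩ := hy _ hu
      exact ⟨.inr q, hq⟩
  choose c hc using hcoset
  obtain ⟨i, j, hne, hij⟩ := Fintype.exists_ne_map_eq_of_card_lt c (by simp [N])
  wlog hlt : i < j generalizing i j
  · exact this j i hne.symm hij.symm (lt_of_le_of_ne (not_lt.1 hlt) hne.symm)
  have hi := hc i
  have hj := hc j
  rw [hij] at hi
  generalize c j = d at hi hj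
  rcases d with p | q
  · have hmem := G.sub_mem hj hi
    rw [sub_sub_sub_cancel_right] at hmem
    exact AddSubgroup.sub_mul_notMem htG hlt j.2.le hmem
  · have hmem := H.sub_mem hj hi
    rw [sub_sub_sub_cancel_right] at hmem
    exact AddSubgroup.sub_mul_notMem htH hlt j.2.le hmem
end

section
/- Let B₁ and B₂ be subsets of ℝ, each simultaneously a Bernstein set and a proper subgroup of (ℝ, +). Then for every finite union U₁ of cosets of B₁ and every finite union U₂ of cosets of B₂, the set U₁ ∪ U₂ is not Lebesgue measurable. -/
open MeasureTheory

/-- A proper subgroup of `ℝ` has infinitely many cosets, as `ℝ` is divisible. -/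
theorem AddSubgroup.exists_forall_sub_notMem_s11 (G : AddSubgroup ℝ) (hG : G ≠ ⊤) {T : Set ℝ}
    (hT : T.Finite) : ∃ y : ℝ, ∀ t ∈ T, y - t ∉ G := by
  by_contra! h
  have hfin : Finite (ℝ ⧸ G) := by
    refine Set.finite_univ_iff.mp ((hT.image (QuotientAddGroup.mk : ℝ → ℝ ⧸ G)).subset ?_)
    intro q _
    obtain ⟨y, rfl⟩ := QuotientAddGroup.mk_surjective q
    obtain ⟨t, ht, hyt⟩ := h y
    refine ⟨t, ht, QuotientAddGroup.eq.mpr ?_⟩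
    rwa [neg_add_eq_sub]
  refine hG ((AddSubgroup.eq_top_iff' G).mpr fun z => ?_)
  have hn : (Nat.card (ℝ ⧸ G) : ℝ) ≠ 0 := Nat.cast_ne_zero.mpr Nat.card_pos.ne'
  have key : Nat.card (ℝ ⧸ G) • ((z / Nat.card (ℝ ⧸ G) : ℝ) : ℝ ⧸ G) = 0 := card_nsmul_eq_zero'
  rw [← QuotientAddGroup.mk_nsmul, QuotientAddGroup.eq_zero_iff, nsmul_eq_mul,
    mul_div_cancel₀ _ hn] at key
  exact key

/-- A measurable set that misses a translate of a Bernstein set is null. -/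
theorem IsBernstein.volume_eq_zero {B S : Set ℝ} (hB : IsBernstein B)
    (hS : NullMeasurableSet S volume) (x : ℝ) (hSB : ∀ s ∈ S, s - x ∉ B) : volume S = 0 := by
  by_contra hpos
  obtain ⟨S', hS'S, hS', hae⟩ := hS.exists_measurable_subset_ae_eq
  have hpos' : 0 < volume S' := by
    rw [measure_congr hae]
    exact pos_iff_ne_zero.mpr hpos
  obtain ⟨K, hKS, hK, hKpos⟩ := hS'.exists_lt_isCompact hpos'
  have hunc : ¬((fun y => y + x) ⁻¹' K).Countable := fun hc => by
    have h0 := hc.measure_zero volume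
    rw [measure_preimage_add_right] at h0
    exact hKpos.ne' h0
  obtain ⟨b, hbK, hbB⟩ := (hB _ (hK.isClosed.preimage (continuous_add_const x)) hunc).1
  refine hSB (b + x) (hS'S (hKS hbK)) ?_
  rwa [add_sub_cancel_right]

/-- A set contained in finitely many cosets of a proper Bernstein subgroup is not conull. -/
theorem IsBernstein.volume_compl_ne_zero {G : AddSubgroup ℝ} (hB : IsBernstein (G : Set ℝ))
    (hG : G ≠ ⊤) {T W : Set ℝ} (hT : T.Finite) (hW : ∀ w ∈ W, ∃ t ∈ T, w - t ∈ G) :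
    volume Wᶜ ≠ 0 := by
  intro h0
  obtain ⟨y, hy⟩ := G.exists_forall_sub_notMem_s11 hG hT
  have hnull : volume W = 0 := by
    refine hB.volume_eq_zero (NullMeasurableSet.of_compl (.of_null h0)) y fun w hw hwy => ?_
    obtain ⟨t, ht, hwt⟩ := hW w hw
    refine hy t ht ?_
    have := G.sub_mem hwt hwy
    rwa [sub_sub_sub_cancel_left] at this
  have : volume (Set.univ : Set ℝ) = 0 := by
    rw [← Set.union_compl_self W]
    exact measure_union_null hnull h0
  simp at this

theorem FinUnionCosets.exists_finite {G : AddSubgroup ℝ} {U : Set ℝ}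
    (hU : FinUnionCosets (G : Set ℝ) U) :
    ∃ T : Set ℝ, T.Finite ∧ T.Nonempty ∧ ∀ u, u ∈ U ↔ ∃ t ∈ T, u - t ∈ G := by
  obtain ⟨m, x, rfl⟩ := hU
  refine ⟨Set.range x, Set.finite_range x, Set.range_nonempty x, fun u => ?_⟩
  simp [sub_eq_add_neg]

theorem stmt_11 (B₁ B₂ : Set ℝ)
    (hB₁ : IsBernstein B₁) (hB₂ : IsBernstein B₂)
    (hsub₁ : ∃ G : AddSubgroup ℝ, (G : Set ℝ) = B₁ ∧ G ≠ ⊤)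
    (hsub₂ : ∃ G : AddSubgroup ℝ, (G : Set ℝ) = B₂ ∧ G ≠ ⊤)
    (U₁ U₂ : Set ℝ) (hU₁ : FinUnionCosets B₁ U₁) (hU₂ : FinUnionCosets B₂ U₂) :
    ¬NullMeasurableSet (U₁ ∪ U₂) volume := by
  intro hmeas
  obtain ⟨G₁, rfl, hG₁⟩ := hsub₁
  obtain ⟨G₂, rfl, hG₂⟩ := hsub₂
  obtain ⟨T₁, hT₁, ⟨x, hx⟩, hU₁⟩ := hU₁.exists_finite
  obtain ⟨T₂, hT₂, -, hU₂⟩ := hU₂.exists_finite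
  have hconull : volume (U₁ ∪ U₂)ᶜ = 0 :=
    hB₁.volume_eq_zero hmeas.compl x fun s hs hsx => hs (Or.inl ((hU₁ s).mpr ⟨x, hx, hsx⟩))
  -- Either translating by some `g ∈ G₂` moves `U₁` off itself, or `G₂` lies in finitely many
  -- cosets of `G₁`.
  by_cases hg : ∃ g ∈ G₂, ∀ s ∈ T₁, ∀ t ∈ T₁, g - (s - t) ∉ G₁
  · obtain ⟨g, hgG, hg⟩ := hg
    refine hB₂.volume_compl_ne_zero hG₂ (W := (U₁ ∪ U₂) ∩ (fun y => y + g) ⁻¹' (U₁ ∪ U₂))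
      hT₂ ?_ ?_
    · rintro w ⟨hw | hw, hwg | hwg⟩
      · obtain ⟨t, ht, hwt⟩ := (hU₁ _).mp hw
        obtain ⟨s, hs, hws⟩ := (hU₁ _).mp hwg
        refine absurd ?_ (hg s hs t ht)
        convert G₁.sub_mem hws hwt using 1
        ring
      · obtain ⟨t, ht, hwt⟩ := (hU₂ _).mp hwg
        refine ⟨t, ht, ?_⟩
        convert G₂.sub_mem hwt hgG using 1
        ring
      · exact (hU₂ _).mp hw
      · exact (hU₂ _).mp hw
    · rw [Set.compl_inter, ← Set.preimage_compl]
      refine measure_union_null hconull ?_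
      rw [measure_preimage_add_right, hconull]
  · push Not at hg
    refine hB₁.volume_compl_ne_zero hG₁ (W := U₁ ∪ U₂)
      (T := T₁ ∪ Set.image2 (· + ·) T₂ (Set.image2 (· - ·) T₁ T₁))
      (hT₁.union (hT₂.image2 _ (hT₁.image2 _ hT₁))) ?_ hconull
    rintro w (hw | hw)
    · obtain ⟨t, ht, hwt⟩ := (hU₁ _).mp hw
      exact ⟨t, Or.inl ht, hwt⟩
    · obtain ⟨u, hu, hwu⟩ := (hU₂ _).mp hw
      obtain ⟨s, hs, t, ht, hst⟩ := hg _ hwu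
      refine ⟨u + (s - t), Or.inr ⟨u, hu, s - t, ⟨s, hs, t, ht, rfl⟩, rfl⟩, ?_⟩
      rwa [← sub_sub]
end

section
/- Let B₁ and B₂ be subsets of ℝ, each simultaneously a Bernstein set and a proper subgroup of (ℝ, +). Then for every finite union U₁ of cosets of B₁, every finite union U₂ of cosets of B₂, and all sets M, N ⊆ ℝ of Lebesgue measure zero, the set (((U₁ ∪ U₂) \ M) ∪ N) is not Lebesgue measurable. -/
open MeasureTheory

open scoped Pointwise

theorem AddSubgroup.eq_top_of_finiteIndex_real (G : AddSubgroup ℝ) (h : G.FiniteIndex) :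
    G = ⊤ := by
  refine eq_top_iff.2 fun x _ => ?_
  have hx := G.nsmul_index_mem (x / G.index)
  have hn : (G.index : ℝ) ≠ 0 := Nat.cast_ne_zero.2 h.index_ne_zero
  rwa [nsmul_eq_mul, mul_div_cancel₀ _ hn] at hx

/-- Finitely many cosets of two proper subgroups do not cover `ℝ`. -/
theorem AddSubgroup.exists_forall_sub_notMem_real {G₁ G₂ : AddSubgroup ℝ} (h₁ : G₁ ≠ ⊤)
    (h₂ : G₂ ≠ ⊤) (S₁ S₂ : Finset ℝ) :
    ∃ d : ℝ, (∀ s ∈ S₁, d - s ∉ G₁) ∧ ∀ s ∈ S₂, d - s ∉ G₂ := by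
  by_contra! hcon
  let H : ℝ ⊕ ℝ → AddSubgroup ℝ := Sum.elim (fun _ => G₁) fun _ => G₂
  let g : ℝ ⊕ ℝ → ℝ := Sum.elim id id
  have hcov : ⋃ i ∈ S₁.disjSum S₂, g i +ᵥ (H i : Set ℝ) = Set.univ := by
    refine Set.eq_univ_of_forall fun d => ?_
    simp only [Set.mem_iUnion, exists_prop, Set.mem_vadd_set_iff_neg_vadd_mem, vadd_eq_add]
    by_cases hd : ∀ s ∈ S₁, d - s ∉ G₁
    · obtain ⟨s, hs, hds⟩ := hcon d hd
      exact ⟨.inr s, by simpa using hs, by simpa [H, g, neg_add_eq_sub] using hds⟩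
    · push Not at hd
      obtain ⟨s, hs, hds⟩ := hd
      exact ⟨.inl s, by simpa using hs, by simpa [H, g, neg_add_eq_sub] using hds⟩
  obtain ⟨k, -, hk⟩ := AddSubgroup.exists_finiteIndex_of_leftCoset_cover hcov
  rcases k with k | k
  · exact h₁ (G₁.eq_top_of_finiteIndex_real hk)
  · exact h₂ (G₂.eq_top_of_finiteIndex_real hk)

/-- A null measurable set containing a translate of a Bernstein set is conull. -/
theorem IsBernstein.volume_compl_eq_zero {B U : Set ℝ} (hB : IsBernstein B) {x : ℝ}
    (hBU : ∀ b ∈ B, b + x ∈ U) (hU : NullMeasurableSet U volume) : volume Uᶜ = 0 := by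
  by_contra hne
  obtain ⟨t, htU, ht, hte⟩ := hU.compl.exists_measurable_subset_ae_eq
  rw [← measure_congr hte] at hne
  obtain ⟨K, hKt, hK, hKpos⟩ := ht.exists_lt_isCompact (pos_iff_ne_zero.2 hne)
  have hpre : volume ((fun b => b + x) ⁻¹' K) = volume K := measure_preimage_add_right _ _ _
  obtain ⟨b, hbK, hb⟩ := (hB ((fun b => b + x) ⁻¹' K)
    (hK.isClosed.preimage (by fun_prop)) fun hc => hKpos.ne' (hpre ▸ hc.measure_zero _)).1
  exact htU (hKt hbK) (hBU b hb)

/-- A finite union of cosets of two proper subgroups is not conull. -/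
theorem AddSubgroup.volume_compl_cosets_ne_zero {G₁ G₂ : AddSubgroup ℝ} (h₁ : G₁ ≠ ⊤)
    (h₂ : G₂ ≠ ⊤) (X₁ X₂ : Finset ℝ) {U : Set ℝ}
    (hU : ∀ u ∈ U, (∃ x ∈ X₁, u - x ∈ G₁) ∨ ∃ x ∈ X₂, u - x ∈ G₂) : volume Uᶜ ≠ 0 := by
  intro h0
  obtain ⟨t, ht₁, ht₂⟩ := exists_forall_sub_notMem_real h₁ h₂ (X₁ - X₁) (X₂ - X₂)
  obtain ⟨r, hr₁, hr₂⟩ := exists_forall_sub_notMem_real h₁ h₂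
    ((X₁ - X₁) ∪ ((X₁ - X₁) + {t})) ((X₂ - X₂) ∪ ((X₂ - X₂) + {t}))
  have key (a : ℝ) : ∀ᵐ z : ℝ, z + a ∈ U := by
    change volume ((fun z => z + a) ⁻¹' Uᶜ) = 0
    rwa [measure_preimage_add_right]
  obtain ⟨z, hz0, hzt, hzr⟩ := ((key 0).and ((key t).and (key r))).exists
  have sep {G : AddSubgroup ℝ} {X : Finset ℝ} (a b : ℝ)
      (hab : ∀ s ∈ X - X, b - a - s ∉ G) :
      (∃ x ∈ X, z + a - x ∈ G) → (∃ x ∈ X, z + b - x ∈ G) → False := by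
    rintro ⟨x, hx, hxG⟩ ⟨y, hy, hyG⟩
    refine hab (y - x) (Finset.sub_mem_sub hy hx) ?_
    convert G.sub_mem hyG hxG using 1
    ring
  have sep_r {G : AddSubgroup ℝ} {X : Finset ℝ}
      (h : ∀ s ∈ (X - X) ∪ ((X - X) + {t}), r - s ∉ G) :
      (∀ s ∈ X - X, r - 0 - s ∉ G) ∧ ∀ s ∈ X - X, r - t - s ∉ G := by
    refine ⟨fun s hs => ?_, fun s hs => ?_⟩
    · simpa using h s (Finset.mem_union_left _ hs)
    · have := h (s + t) (Finset.mem_union_right _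
        (Finset.add_mem_add hs (Finset.mem_singleton_self t)))
      rwa [show r - t - s = r - (s + t) by ring]
  have a₁ := sep (G := G₁) (X := X₁) 0 t (by simpa only [sub_zero] using ht₁)
  have a₂ := sep (G := G₂) (X := X₂) 0 t (by simpa only [sub_zero] using ht₂)
  have b₁ := sep 0 r (sep_r hr₁).1
  have b₂ := sep 0 r (sep_r hr₂).1
  have c₁ := sep t r (sep_r hr₁).2
  have c₂ := sep t r (sep_r hr₂).2
  -- Two of the three points lie in cosets of the same subgroup.
  rcases hU _ hz0 with d0 | d0 <;> rcases hU _ hzt with dt | dt <;>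
    rcases hU _ hzr with dr | dr
  exacts [a₁ d0 dt, a₁ d0 dt, b₁ d0 dr, c₂ dt dr, c₁ dt dr, b₂ d0 dr, a₂ d0 dt, a₂ d0 dt]

theorem stmt_12 (B₁ B₂ : Set ℝ)
    (hB₁ : IsBernstein B₁) (hB₂ : IsBernstein B₂)
    (hsub₁ : ∃ G : AddSubgroup ℝ, (G : Set ℝ) = B₁ ∧ G ≠ ⊤)
    (hsub₂ : ∃ G : AddSubgroup ℝ, (G : Set ℝ) = B₂ ∧ G ≠ ⊤)
    (U₁ U₂ : Set ℝ) (hU₁ : FinUnionCosets B₁ U₁) (hU₂ : FinUnionCosets B₂ U₂)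
    (M N : Set ℝ) (hM : volume M = 0) (hN : volume N = 0) :
    ¬NullMeasurableSet (((U₁ ∪ U₂) \ M) ∪ N) volume := by
  intro hmeas
  obtain ⟨G₁, rfl, h₁⟩ := hsub₁
  obtain ⟨G₂, rfl, h₂⟩ := hsub₂
  obtain ⟨m₁, x₁, rfl⟩ := hU₁
  obtain ⟨m₂, x₂, rfl⟩ := hU₂
  have hmeasU := hmeas.congr
    ((union_ae_eq_left_of_ae_eq_empty (ae_eq_empty.2 hN)).trans (sdiff_null_ae_eq_self hM))
  refine AddSubgroup.volume_compl_cosets_ne_zero h₁ h₂ (Finset.univ.image x₁)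
    (Finset.univ.image x₂) ?_ (hB₁.volume_compl_eq_zero (x := x₁ 0) ?_ hmeasU)
  · rintro u (hu | hu)
    · obtain ⟨i, b, hb, rfl⟩ := Set.mem_iUnion.1 hu
      exact .inl ⟨x₁ i, by simp, by simpa using hb⟩
    · obtain ⟨i, b, hb, rfl⟩ := Set.mem_iUnion.1 hu
      exact .inr ⟨x₂ i, by simp, by simpa using hb⟩
  · exact fun b hb => .inl (Set.mem_iUnion.2 ⟨0, b, hb, rfl⟩)
end

section
/- Let B₁ and B₂ be subsets of ℝ, each simultaneously a Bernstein set and a proper subgroup of (ℝ, +). Let U₁ be a finite union of cosets of B₁ and let U₂, U₃ be finite unions of cosets of B₂. Then the set (U₁ \ U₂) ∪ U₃ is not Lebesgue measurable. -/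
open MeasureTheory

lemma AddSubgroup.exists_notMem_of_ne_top {A : Type*} [AddGroup A] {G H : AddSubgroup A}
    (hG : G ≠ ⊤) (hH : H ≠ ⊤) : ∃ t, t ∉ G ∧ t ∉ H := by
  obtain ⟨a, ha⟩ : ∃ a, a ∉ G := by
    by_contra! h
    exact hG ((AddSubgroup.eq_top_iff' G).2 h)
  obtain ⟨b, hb⟩ : ∃ b, b ∉ H := by
    by_contra! h
    exact hH ((AddSubgroup.eq_top_iff' H).2 h)
  by_cases haH : a ∈ H
  · by_cases hbG : b ∈ G
    · exact ⟨a + b, fun h => ha ((G.add_mem_cancel_right hbG).1 h),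
        fun h => hb ((H.add_mem_cancel_left haH).1 h)⟩
    · exact ⟨b, hbG, hb⟩
  · exact ⟨a, ha, haH⟩

lemma AddSubgroup.eq_top_of_finiteIndex_rat (H : AddSubgroup ℚ) [H.FiniteIndex] : H = ⊤ := by
  refine (AddSubgroup.eq_top_iff' H).2 fun q => ?_
  have h := H.nsmul_index_mem (q / H.index)
  have h0 : (H.index : ℚ) ≠ 0 := Nat.cast_ne_zero.2 AddSubgroup.FiniteIndex.index_ne_zero
  rwa [nsmul_eq_mul, mul_div_cancel₀ _ h0] at h

/-- A finite union of cosets of subgroups missing a common element `t` contains no translate of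
the rational line through `t`. -/
lemma exists_rat_mul_notMem_iUnion_cosets {ι : Type*} [Fintype ι] (G : ι → AddSubgroup ℝ)
    (c : ι → ℝ) {t : ℝ} (ht : ∀ i, t ∉ G i) (x : ℝ) :
    ∃ q : ℚ, ∀ i, x + q * t - c i ∉ G i := by
  by_contra! hcov
  let f : ℚ →+ ℝ := (AddMonoidHom.mulRight t).comp (Rat.castHom ℝ).toAddMonoidHom
  have hf (q : ℚ) : f q = q * t := rfl
  have hg (i : ι) : ∃ g : ℚ, ∀ q : ℚ, x + q * t - c i ∈ G i → q - g ∈ (G i).comap f := by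
    by_cases h : ∃ g : ℚ, x + g * t - c i ∈ G i
    · obtain ⟨g, hg⟩ := h
      refine ⟨g, fun q hq => ?_⟩
      have := (G i).sub_mem hq hg
      rw [AddSubgroup.mem_comap, hf]
      convert this using 1
      push_cast
      ring
    · exact ⟨0, fun q hq => (h ⟨q, hq⟩).elim⟩
  choose g hg using hg
  obtain ⟨k, -, hk⟩ := AddSubgroup.exists_finiteIndex_of_leftCoset_cover
    (s := Finset.univ) (H := fun i => (G i).comap f) (g := g) (by
      refine Set.eq_univ_of_forall fun q => ?_
      obtain ⟨i, hi⟩ := hcov q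
      refine Set.mem_iUnion₂.2 ⟨i, Finset.mem_univ i, ?_⟩
      rw [Set.mem_vadd_set_iff_neg_vadd_mem, vadd_eq_add, neg_add_eq_sub]
      exact hg i q hi)
  have h1 : (1 : ℚ) ∈ (G k).comap f := by
    rw [AddSubgroup.eq_top_of_finiteIndex_rat ((G k).comap f)]
    trivial
  rw [AddSubgroup.mem_comap, hf, Rat.cast_one, one_mul] at h1
  exact ht k h1

/-- The complement of a finite union of cosets of subgroups missing a common element is not
null. -/
lemma volume_compl_iUnion_cosets_ne_zero {ι : Type*} [Fintype ι] (G : ι → AddSubgroup ℝ)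
    (c : ι → ℝ) {t : ℝ} (ht : ∀ i, t ∉ G i) :
    volume {y : ℝ | ∀ i, y - c i ∉ G i} ≠ 0 := by
  intro h0
  have hnull : volume (⋃ q : ℚ, (fun x : ℝ => x + q * t) ⁻¹' {y | ∀ i, y - c i ∉ G i}) = 0 :=
    measure_iUnion_null fun q => by rw [measure_preimage_add_right, h0]
  have huniv : (⋃ q : ℚ, (fun x : ℝ => x + q * t) ⁻¹' {y | ∀ i, y - c i ∉ G i}) = Set.univ :=
    Set.eq_univ_of_forall fun x =>
      Set.mem_iUnion.2 (exists_rat_mul_notMem_iUnion_cosets G c ht x)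
  rw [huniv, Real.volume_univ] at hnull
  exact ENNReal.top_ne_zero hnull

lemma FinUnionCosets.exists_mem_iff {G : AddSubgroup ℝ} {U : Set ℝ}
    (hU : FinUnionCosets (G : Set ℝ) U) :
    ∃ (m : ℕ) (c : Fin (m + 1) → ℝ), ∀ y, y ∈ U ↔ ∃ i, y - c i ∈ G := by
  obtain ⟨m, c, rfl⟩ := hU
  refine ⟨m, c, fun y => ?_⟩
  simp only [Set.mem_iUnion, Set.mem_image, SetLike.mem_coe]
  refine exists_congr fun i => ⟨?_, fun h => ⟨_, h, sub_add_cancel _ _⟩⟩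
  rintro ⟨b, hb, rfl⟩
  rwa [add_sub_cancel_right]

/-- A finite union of translates of a Bernstein set meets every uncountable closed set. -/
lemma FinUnionCosets.inter_nonempty {B U F : Set ℝ} (hU : FinUnionCosets B U)
    (hB : IsBernstein B) (hF : IsClosed F) (hF' : ¬F.Countable) : (F ∩ U).Nonempty := by
  obtain ⟨m, c, rfl⟩ := hU
  have hcl : IsClosed ((fun b => b + c 0) ⁻¹' F) := hF.preimage (by fun_prop)
  have hunc : ¬((fun b => b + c 0) ⁻¹' F).Countable := fun h => hF' <| by
    have := h.image (fun b => b + c 0)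
    rwa [Set.image_preimage_eq _ (add_right_surjective (c 0))] at this
  obtain ⟨b, hbF, hbB⟩ := (hB _ hcl hunc).1
  exact ⟨b + c 0, hbF, Set.mem_iUnion.2 ⟨0, b, hbB, rfl⟩⟩

lemma MeasureTheory.NullMeasurableSet.exists_isClosed_not_countable {s : Set ℝ}
    (hs : NullMeasurableSet s volume) (h0 : volume s ≠ 0) :
    ∃ F ⊆ s, IsClosed F ∧ ¬F.Countable := by
  obtain ⟨t, hts, ht, hae⟩ := hs.exists_measurable_subset_ae_eq
  obtain ⟨K, hKt, hK, hpos⟩ := ht.exists_lt_isCompact (μ := volume) (r := 0)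
    (by rw [measure_congr hae]; exact pos_iff_ne_zero.2 h0)
  exact ⟨K, hKt.trans hts, hK.isClosed, fun h => hpos.ne' (h.measure_zero _)⟩

theorem stmt_13 (B₁ B₂ : Set ℝ)
    (hB₁ : IsBernstein B₁) (hB₂ : IsBernstein B₂)
    (hsub₁ : ∃ G : AddSubgroup ℝ, (G : Set ℝ) = B₁ ∧ G ≠ ⊤)
    (hsub₂ : ∃ G : AddSubgroup ℝ, (G : Set ℝ) = B₂ ∧ G ≠ ⊤)
    (U₁ U₂ U₃ : Set ℝ) (hU₁ : FinUnionCosets B₁ U₁)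
    (hU₂ : FinUnionCosets B₂ U₂) (hU₃ : FinUnionCosets B₂ U₃) :
    ¬NullMeasurableSet ((U₁ \ U₂) ∪ U₃) volume := by
  intro hE
  obtain ⟨G₁, rfl, hG₁⟩ := hsub₁
  obtain ⟨G₂, rfl, hG₂⟩ := hsub₂
  obtain ⟨t, ht₁, ht₂⟩ := AddSubgroup.exists_notMem_of_ne_top hG₁ hG₂
  obtain ⟨m₁, c₁, hc₁⟩ := hU₁.exists_mem_iff
  obtain ⟨m₃, c₃, hc₃⟩ := hU₃.exists_mem_iff
  have hne : volume ((U₁ \ U₂) ∪ U₃)ᶜ ≠ 0 := by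
    refine fun h0 => volume_compl_iUnion_cosets_ne_zero
      (Sum.elim (fun _ : Fin (m₁ + 1) => G₁) fun _ : Fin (m₃ + 1) => G₂) (Sum.elim c₁ c₃) (t := t)
      (by rintro (i | i) <;> assumption) (measure_mono_null ?_ h0)
    rintro y hy (⟨hy₁, -⟩ | hy₃)
    · obtain ⟨i, hi⟩ := (hc₁ y).1 hy₁
      exact hy (Sum.inl i) hi
    · obtain ⟨i, hi⟩ := (hc₃ y).1 hy₃
      exact hy (Sum.inr i) hi
  obtain ⟨F, hFE, hF, hF'⟩ := hE.compl.exists_isClosed_not_countable hne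
  obtain ⟨y, hyF, hyU⟩ := hU₃.inter_nonempty hB₂ hF hF'
  exact hFE hyF (Or.inr hyU)
end

section
/- Let Q₁ and Q₂ be countable dense subgroups of (ℝ, +), and let V₁ and V₂ be Vitali selectors related to Q₁ and Q₂ respectively. Then at least one of the three sets V₁ \ V₂, V₂ \ V₁, and V₁ ∩ V₂ is not Lebesgue measurable. -/
open MeasureTheory

/-- `V` is a Vitali selector related to the subgroup `Q` of `(ℝ, +)`:
`V` contains exactly one point from each coset of `Q`. -/
def IsVitaliSelector (Q : AddSubgroup ℝ) (V : Set ℝ) : Prop :=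
  ∀ x : ℝ, ∃! v : ℝ, v ∈ V ∧ x - v ∈ Q

/-- A Vitali selector of a countable subgroup has positive outer measure, since its countably many
translates cover the line. -/
theorem IsVitaliSelector.volume_ne_zero {Q : AddSubgroup ℝ} {V : Set ℝ}
    (hV : IsVitaliSelector Q V) (hc : (Q : Set ℝ).Countable) : volume V ≠ 0 := by
  intro h0
  have hcover : (Set.univ : Set ℝ) ⊆ ⋃ q ∈ (Q : Set ℝ), (fun x => x - q) ⁻¹' V := by
    intro x _
    obtain ⟨v, ⟨hv, hq⟩, -⟩ := hV x
    simp only [Set.mem_iUnion, Set.mem_preimage]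
    exact ⟨x - v, hq, by simpa using hv⟩
  have hnull : volume (⋃ q ∈ (Q : Set ℝ), (fun x => x - q) ⁻¹' V) = 0 := by
    rw [measure_biUnion_null_iff hc]
    intro q _
    rw [(measurePreserving_sub_right volume q).measure_preimage
      (NullMeasurableSet.of_null h0), h0]
  have := measure_mono_null hcover hnull
  simp at this

/-- A Vitali selector of a countable dense subgroup is not Lebesgue measurable. -/
theorem IsVitaliSelector.not_nullMeasurableSet {Q : AddSubgroup ℝ} {V : Set ℝ}
    (hV : IsVitaliSelector Q V) (hc : (Q : Set ℝ).Countable) (hd : Dense (Q : Set ℝ)) :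
    ¬NullMeasurableSet V volume := by
  intro hm
  obtain ⟨E, hEV, hE, hae⟩ := hm.exists_measurable_subset_ae_eq
  have hpos : 0 < volume E := by
    rw [measure_congr hae]
    exact pos_iff_ne_zero.2 (hV.volume_ne_zero hc)
  obtain ⟨q, ⟨hqQ, hq0⟩, hqE⟩ := (hd.sdiff_singleton 0).inter_nhds_nonempty
    (Measure.sub_mem_nhds_zero_of_addHaar_pos volume E hE hpos)
  obtain ⟨x, hx, y, hy, rfl⟩ := hqE
  exact hq0 (sub_eq_zero.2 ((hV x).unique ⟨hEV hx, by simp [Q.zero_mem]⟩ ⟨hEV hy, hqQ⟩))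

theorem stmt_14 (Q₁ Q₂ : AddSubgroup ℝ)
    (hc₁ : (Q₁ : Set ℝ).Countable) (hd₁ : Dense (Q₁ : Set ℝ))
    (hc₂ : (Q₂ : Set ℝ).Countable) (hd₂ : Dense (Q₂ : Set ℝ))
    (V₁ V₂ : Set ℝ)
    (hV₁ : IsVitaliSelector Q₁ V₁) (hV₂ : IsVitaliSelector Q₂ V₂) :
    ¬NullMeasurableSet (V₁ \ V₂) volume ∨
    ¬NullMeasurableSet (V₂ \ V₁) volume ∨
    ¬NullMeasurableSet (V₁ ∩ V₂) volume := by
  by_contra! h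
  refine hV₁.not_nullMeasurableSet hc₁ hd₁ ?_
  rw [← Set.sdiff_union_inter V₁ V₂]
  exact h.1.union h.2.2
end

section
/- Let n ≥ 1 and, for each i = 1, …, n, let Vᵢ be a Vitali selector related to a countable dense subgroup Qᵢ of (ℝ, +). Then the union U = V₁ ∪ V₂ ∪ ⋯ ∪ Vₙ contains no Lebesgue measurable set of positive Lebesgue measure; equivalently, every Lebesgue measurable subset of U has Lebesgue measure zero. -/
open MeasureTheory

open Filter Topology Pointwise

theorem IsVitaliSelector.eq_of_sub_mem {Q : AddSubgroup ℝ} {V : Set ℝ}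
    (hV : IsVitaliSelector Q V) {x y : ℝ} (hx : x ∈ V) (hy : y ∈ V) (hxy : x - y ∈ Q) :
    x = y :=
  (hV x).unique ⟨hx, by simp⟩ ⟨hy, hxy⟩

/-- An `n`-colouring of the grid `{0, …, n}ⁿ` has two distinct points of the same colour `i`
that differ only in their `i`-th coordinate. -/
theorem exists_ne_same_color_eq_off_color {n : ℕ} (c : (Fin n → Fin (n + 1)) → Fin n) :
    ∃ a b, a ≠ b ∧ c a = c b ∧ ∀ j, j ≠ c a → a j = b j := by
  let f : (Fin n → Fin (n + 1)) → Σ i : Fin n, ({j : Fin n // j ≠ i} → Fin (n + 1)) :=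
    fun a => ⟨c a, fun j => a j⟩
  obtain ⟨a, b, hab, h⟩ : ∃ a b, a ≠ b ∧ f a = f b := by
    refine Fintype.exists_ne_map_eq_of_card_lt f ?_
    rcases n with _ | n
    · simp
    · simp only [Fintype.card_sigma, Fintype.card_fun, Fintype.card_fin, ne_eq,
        Fintype.card_subtype_compl, Fintype.card_unique, Finset.sum_const, Finset.card_univ,
        smul_eq_mul, add_tsub_cancel_right]
      rw [pow_succ' _ n]
      gcongr
      omega
  have hc : c a = c b := congrArg Sigma.fst h
  refine ⟨a, b, hab, hc, fun j hj => ?_⟩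
  have key : ∀ i i' (g : {j : Fin n // j ≠ i} → Fin (n + 1))
      (g' : {j : Fin n // j ≠ i'} → Fin (n + 1)),
      (⟨i, g⟩ : Σ i : Fin n, ({j : Fin n // j ≠ i} → Fin (n + 1))) = ⟨i', g'⟩ →
      ∀ (h : j ≠ i) (h' : j ≠ i'), g ⟨j, h⟩ = g' ⟨j, h'⟩ := by
    intro i i' g g' e h h'
    cases e
    rfl
  exact key _ _ _ _ h hj (hc ▸ hj)

/-- If finitely many translation amounts depend continuously on a parameter and vanish at `q₀`,
then for parameters near `q₀` a compact set of positive measure contains a translate of the whole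
family. -/
theorem IsCompact.eventually_exists_forall_add_mem {K : Set ℝ} (hK : IsCompact K)
    (hpos : volume K ≠ 0) {ι X : Type*} [Fintype ι] [TopologicalSpace X] {q₀ : X}
    {f : ι → X → ℝ} (hf : ∀ a, Tendsto (f a) (𝓝 q₀) (𝓝 0)) :
    ∀ᶠ q in 𝓝 q₀, ∃ x, ∀ a, f a q + x ∈ K := by
  have hsum : Tendsto (fun q => ∑ a, volume ((f a q +ᵥ K) \ K)) (𝓝 q₀) (𝓝 0) := by
    have h := tendsto_finsetSum Finset.univ fun a _ =>
      (tendsto_measure_vadd_sdiff_isCompact_isClosed (μ := volume) hK hK.isClosed).comp (hf a)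
    simpa using h
  filter_upwards [hsum.eventually_lt_const (pos_iff_ne_zero.2 hpos)] with q hq
  by_contra! hx
  refine hq.not_ge ?_
  have hcover : K ⊆ ⋃ a, K \ (-f a q +ᵥ K) := by
    intro x hxK
    obtain ⟨a, ha⟩ := hx x
    refine Set.mem_iUnion.2 ⟨a, hxK, ?_⟩
    rwa [Set.mem_vadd_set_iff_neg_vadd_mem, neg_neg]
  calc volume K ≤ volume (⋃ a, K \ (-f a q +ᵥ K)) := measure_mono hcover
    _ ≤ ∑ a, volume (K \ (-f a q +ᵥ K)) := measure_iUnion_fintype_le _ _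
    _ = ∑ a, volume ((f a q +ᵥ K) \ K) := by
      refine Finset.sum_congr rfl fun a _ => ?_
      rw [← measure_vadd volume (f a q) (K \ (-f a q +ᵥ K)), Set.vadd_set_sdiff, vadd_neg_vadd]

theorem stmt_15 (n : ℕ) (hn : 1 ≤ n)
    (Q : Fin n → AddSubgroup ℝ)
    (hc : ∀ i, ((Q i : Set ℝ)).Countable) (hd : ∀ i, Dense ((Q i : Set ℝ)))
    (V : Fin n → Set ℝ) (hV : ∀ i, IsVitaliSelector (Q i) (V i)) :
    ∀ Y : Set ℝ, Y ⊆ ⋃ i, V i → NullMeasurableSet Y volume → volume Y = 0 := by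
  intro Y hYV hY
  by_contra hpos
  obtain ⟨T, hTY, hT, hTae⟩ := hY.exists_measurable_subset_ae_eq
  rw [← measure_congr hTae] at hpos
  obtain ⟨K, hKT, hK, hKpos⟩ := hT.exists_lt_isCompact (pos_iff_ne_zero.2 hpos)
  have hf (a : Fin n → Fin (n + 1)) :
      Tendsto (fun q : Fin n → ℝ => ∑ i, ((a i : ℕ) : ℝ) * q i) (𝓝 0) (𝓝 0) :=
    Continuous.tendsto' (by fun_prop) _ _ (by simp)
  obtain ⟨δ, hδ, hball⟩ := Metric.eventually_nhds_iff.1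
    (hK.eventually_exists_forall_add_mem hKpos.ne' hf)
  choose q hqQ hq using fun i => (hd i).exists_between hδ
  obtain ⟨x, hx⟩ := hball (y := q) <| (dist_pi_lt_iff hδ).2 fun i => by
    simpa [abs_of_pos (hq i).1] using (hq i).2
  choose c hcV using fun a => Set.mem_iUnion.1 (hYV (hTY (hKT (hx a))))
  obtain ⟨a, b, hab, hcab, hoff⟩ := exists_ne_same_color_eq_off_color c
  have hdiff : (∑ i, ((a i : ℕ) : ℝ) * q i + x) - (∑ i, ((b i : ℕ) : ℝ) * q i + x) =
      (((a (c a) : ℕ) : ℝ) - ((b (c a) : ℕ) : ℝ)) * q (c a) := by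
    rw [add_sub_add_right_eq_sub, ← Finset.sum_sub_distrib,
      Finset.sum_eq_single_of_mem (c a) (Finset.mem_univ _), sub_mul]
    intro j _ hj
    rw [hoff j hj, sub_self]
  have heq := (hV (c a)).eq_of_sub_mem (hcV a) (hcab ▸ hcV b) <| by
    rw [hdiff, sub_mul, ← nsmul_eq_mul, ← nsmul_eq_mul]
    exact sub_mem (nsmul_mem (hqQ _) _) (nsmul_mem (hqQ _) _)
  rw [← sub_eq_zero, hdiff, mul_eq_zero, or_iff_left (hq _).1.ne', sub_eq_zero,
    Nat.cast_inj, Fin.val_inj] at heq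
  refine hab (funext fun j => ?_)
  by_cases hj : j = c a
  · rw [hj, heq]
  · exact hoff j hj
end

section
/- Let m ≥ 1 and, for each k = 1, …, m, let U_k be a finite union of Vitali selectors of ℝ related to a countable dense subgroup Q_k of (ℝ, +), and let h_k : ℝ → ℝ be a topological group automorphism of (ℝ, +) (an additive group isomorphism of ℝ onto itself that is a homeomorphism). Then the set U = h₁(U₁) ∪ ⋯ ∪ h_m(U_m) contains no Lebesgue measurable set of positive Lebesgue measure. -/
open MeasureTheory

/-- `U` is a finite union of Vitali selectors, all related to the subgroup `Q`. -/
def FinUnionVitaliSelectors (Q : AddSubgroup ℝ) (U : Set ℝ) : Prop :=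
  ∃ (n : ℕ) (V : Fin (n + 1) → Set ℝ),
    (∀ i, IsVitaliSelector Q (V i)) ∧ U = ⋃ i, V i

/-- The set `U` meets every coset of `Q` in a uniformly bounded number of points. -/
def BoundedOnCosets (Q : AddSubgroup ℝ) (U : Set ℝ) : Prop :=
  ∃ k : ℕ, ∀ F : Finset ℝ, (F : Set ℝ) ⊆ U → (∀ x ∈ F, ∀ y ∈ F, x - y ∈ Q) → F.card ≤ k

theorem IsVitaliSelector.boundedOnCosets {Q : AddSubgroup ℝ} {V : Set ℝ}
    (hV : IsVitaliSelector Q V) : BoundedOnCosets Q V := by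
  refine ⟨1, fun F hF hQ => Finset.card_le_one.2 fun x hx y hy => ?_⟩
  exact (hV x).unique ⟨hF hx, by simp⟩ ⟨hF hy, hQ x hx y hy⟩

theorem BoundedOnCosets.biUnion {ι : Type*} {Q : AddSubgroup ℝ} {U : ι → Set ℝ} (s : Finset ι)
    (hU : ∀ i ∈ s, BoundedOnCosets Q (U i)) : BoundedOnCosets Q (⋃ i ∈ s, U i) := by
  classical
  choose! k hk using hU
  refine ⟨∑ i ∈ s, k i, fun F hF hQ => ?_⟩
  have hcover : F ⊆ s.biUnion fun i => F.filter (· ∈ U i) := by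
    intro x hx
    obtain ⟨i, hi, hxi⟩ := Set.mem_iUnion₂.1 (hF hx)
    exact Finset.mem_biUnion.2 ⟨i, hi, Finset.mem_filter.2 ⟨hx, hxi⟩⟩
  refine (Finset.card_le_card hcover).trans (Finset.card_biUnion_le.trans ?_)
  refine Finset.sum_le_sum fun i hi => hk i hi _ (fun x hx => (Finset.mem_filter.1 hx).2) ?_
  exact fun x hx y hy => hQ x (Finset.mem_filter.1 hx).1 y (Finset.mem_filter.1 hy).1

theorem BoundedOnCosets.preimage_add_right {Q : AddSubgroup ℝ} {U : Set ℝ}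
    (hU : BoundedOnCosets Q U) (f : ℝ) : BoundedOnCosets Q ((· + f) ⁻¹' U) := by
  obtain ⟨k, hk⟩ := hU
  refine ⟨k, fun F hF hQ => ?_⟩
  rw [← Finset.card_map (addRightEmbedding f)]
  refine hk _ ?_ ?_
  · intro x hx
    obtain ⟨y, hy, rfl⟩ := Finset.mem_map.1 hx
    exact hF hy
  · intro x hx y hy
    obtain ⟨x', hx', rfl⟩ := Finset.mem_map.1 hx
    obtain ⟨y', hy', rfl⟩ := Finset.mem_map.1 hy
    simpa using hQ x' hx' y' hy'

theorem BoundedOnCosets.image {Q : AddSubgroup ℝ} {U : Set ℝ} (hU : BoundedOnCosets Q U)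
    (h : ℝ ≃+ ℝ) : BoundedOnCosets (Q.map h.toAddMonoidHom) (h '' U) := by
  obtain ⟨k, hk⟩ := hU
  refine ⟨k, fun F hF hQ => ?_⟩
  rw [← Finset.card_map h.symm.toEquiv.toEmbedding]
  refine hk _ ?_ ?_
  · intro x hx
    obtain ⟨y, hy, rfl⟩ := Finset.mem_map.1 hx
    obtain ⟨u, hu, rfl⟩ := hF hy
    simpa using hu
  · intro x hx y hy
    obtain ⟨x', hx', rfl⟩ := Finset.mem_map.1 hx
    obtain ⟨y', hy', rfl⟩ := Finset.mem_map.1 hy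
    obtain ⟨q, hq, hqe⟩ := hQ x' hx' y' hy'
    have hqe : h q = x' - y' := hqe
    have : h.symm x' - h.symm y' = q := by rw [← map_sub, ← hqe, h.symm_apply_apply]
    simpa [this] using hq

theorem FinUnionVitaliSelectors.boundedOnCosets {Q : AddSubgroup ℝ} {U : Set ℝ}
    (hU : FinUnionVitaliSelectors Q U) : BoundedOnCosets Q U := by
  obtain ⟨n, V, hV, rfl⟩ := hU
  simpa using BoundedOnCosets.biUnion (Q := Q) (U := V) Finset.univ
    fun i _ => (hV i).boundedOnCosets

/-- A set of positive measure meets some translate of itself, by an element of a countable dense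
set avoiding finitely many points, in a set of positive measure. -/
theorem exists_volume_inter_preimage_add_ne_zero {D : Set ℝ} (hc : D.Countable) (hd : Dense D)
    (F : Finset ℝ) {A : Set ℝ} (hA : MeasurableSet A) (hpos : volume A ≠ 0) :
    ∃ q ∈ D, q ∉ F ∧ volume (A ∩ (· + q) ⁻¹' A) ≠ 0 := by
  by_contra! hnull
  set N : Set ℝ := ⋃ q ∈ D \ F, A ∩ (· + q) ⁻¹' A
  have hN : volume N = 0 :=
    (measure_biUnion_null_iff (hc.mono Set.sdiff_subset)).2 fun q hq => hnull q hq.1 hq.2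
  have hNm : MeasurableSet N := MeasurableSet.biUnion (hc.mono Set.sdiff_subset) fun q _ =>
    hA.inter (measurable_add_const q hA)
  have hpos' : 0 < volume (A \ N) := by
    rw [measure_sdiff_null hN]
    exact pos_iff_ne_zero.2 hpos
  have hnhds := Measure.sub_mem_nhds_zero_of_addHaar_pos volume (A \ N) (hA.diff hNm) hpos'
  obtain ⟨O, hOs, hOo, hO0⟩ := mem_nhds_iff.1 hnhds
  obtain ⟨q, hqO, hqD, hqF⟩ := (hd.sdiff_finset F).inter_open_nonempty O hOo ⟨0, hO0⟩
  obtain ⟨x, hx, y, hy, hxy⟩ := hOs hqO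
  refine hy.2 (Set.mem_biUnion (⟨hqD, hqF⟩ : q ∈ D \ F) ⟨hy.1, ?_⟩)
  have : y + q = x := by rw [← hxy]; ring
  simpa [this] using hx.1

theorem exists_finset_volume_iInter_preimage_add_ne_zero {D : Set ℝ} (hc : D.Countable)
    (hd : Dense D) {A : Set ℝ} (hA : MeasurableSet A) (hpos : volume A ≠ 0) (n : ℕ) :
    ∃ F : Finset ℝ, F.card = n ∧ (F : Set ℝ) ⊆ D ∧
      volume (A ∩ ⋂ f ∈ F, (· + f) ⁻¹' A) ≠ 0 := by
  classical
  induction n with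
  | zero => exact ⟨∅, by simpa using hpos⟩
  | succ n ih =>
    obtain ⟨F, hcard, hFD, hF⟩ := ih
    obtain ⟨q, hqD, hqF, hq⟩ := exists_volume_inter_preimage_add_ne_zero hc hd F
      (hA.inter (F.measurableSet_biInter fun f _ => measurable_add_const f hA)) hF
    refine ⟨insert q F, by rw [Finset.card_insert_of_notMem hqF, hcard], ?_, ?_⟩
    · rw [Finset.coe_insert]
      exact Set.insert_subset hqD hFD
    · rw [Finset.set_biInter_insert]
      refine mt (measure_mono_null ?_) hq
      exact fun x hx => ⟨hx.1.1, hx.2.1, hx.1.2⟩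

theorem volume_eq_zero_of_subset_biUnion_boundedOnCosets {ι : Type*} (Q : ι → AddSubgroup ℝ)
    (hc : ∀ i, (Q i : Set ℝ).Countable) (hd : ∀ i, Dense (Q i : Set ℝ)) (s : Finset ι)
    (U : ι → Set ℝ) (hU : ∀ i ∈ s, BoundedOnCosets (Q i) (U i)) {Y : Set ℝ}
    (hY : MeasurableSet Y) (hYU : Y ⊆ ⋃ i ∈ s, U i) : volume Y = 0 := by
  classical
  induction s using Finset.induction_on generalizing U Y with
  | empty => simp_all
  | insert a s _ ih =>
    by_contra hpos
    obtain ⟨k, hk⟩ := hU a (Finset.mem_insert_self a s)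
    obtain ⟨F, hcard, hFQ, hF⟩ :=
      exists_finset_volume_iInter_preimage_add_ne_zero (hc a) (hd a) hY hpos (k + 1)
    refine hF (ih (fun i => ⋃ f ∈ F, (· + f) ⁻¹' U i) (fun i hi => ?_)
      (hY.inter (F.measurableSet_biInter fun f _ => measurable_add_const f hY)) ?_)
    · exact BoundedOnCosets.biUnion F fun f _ =>
        (hU i (Finset.mem_insert_of_mem hi)).preimage_add_right f
    · intro x hx
      have hxF : ∀ f ∈ F, x + f ∈ Y := fun f hf => Set.mem_iInter₂.1 hx.2 f hf
      obtain ⟨f, hf, hfa⟩ : ∃ f ∈ F, x + f ∉ U a := by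
        by_contra! hall
        have := hk (F.map (addLeftEmbedding x)) ?_ ?_
        · rw [Finset.card_map] at this
          omega
        · intro y hy
          obtain ⟨f, hf, rfl⟩ := Finset.mem_map.1 hy
          exact hall f hf
        · intro y hy z hz
          obtain ⟨f, hf, rfl⟩ := Finset.mem_map.1 hy
          obtain ⟨g, hg, rfl⟩ := Finset.mem_map.1 hz
          simpa using (Q a).sub_mem (hFQ hf) (hFQ hg)
      obtain ⟨i, hi, hxi⟩ := Set.mem_iUnion₂.1 (hYU (hxF f hf))
      rcases Finset.mem_insert.1 hi with rfl | hi
      · exact absurd hxi hfa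
      · exact Set.mem_biUnion hi (Set.mem_biUnion hf hxi)

theorem stmt_16 (m : ℕ) (hm : 1 ≤ m)
    (Q : Fin m → AddSubgroup ℝ)
    (hc : ∀ k, ((Q k : Set ℝ)).Countable) (hd : ∀ k, Dense ((Q k : Set ℝ)))
    (U : Fin m → Set ℝ) (hU : ∀ k, FinUnionVitaliSelectors (Q k) (U k))
    (h : Fin m → (ℝ ≃+ ℝ))
    (hcont : ∀ k, Continuous (h k)) (hcont' : ∀ k, Continuous (h k).symm) :
    ∀ Y : Set ℝ, Y ⊆ ⋃ k, (h k) '' (U k) →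
      NullMeasurableSet Y volume → volume Y = 0 := by
  intro Y hYU hY
  obtain ⟨Z, hZY, hZ, hZae⟩ := hY.exists_measurable_subset_ae_eq
  rw [← measure_congr hZae]
  refine volume_eq_zero_of_subset_biUnion_boundedOnCosets
    (fun k => (Q k).map (h k).toAddMonoidHom) (fun k => (hc k).image _)
    (fun k => (h k).surjective.denseRange.dense_image (hcont k) (hd k)) Finset.univ
    (fun k => h k '' U k) (fun k _ => (hU k).boundedOnCosets.image (h k)) hZ ?_
  simpa using hZY.trans hYU
end
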